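/- arXiv:2007.03853 — 2 statements merged into one kernel-verified Lean document; each statement's English description precedes it below -/
import Mathlib

section
/- Let 1 ≤ q < ∞ and let q₁, q₂, s₁, s₂ ∈ [1,∞] satisfy 1/q₁ + 1/q₂ = 1/s₁ + 1/s₂ = 1/q. Let g, f : ℝ × ℝ → ℝ be measurable, 1-periodic in the second variable τ, with ‖g‖_{L^{q₁}(ℝ; L^{s₁}(𝕋¹))} < ∞ and ‖f‖_{L^{q₂}(ℝ; L^{s₂}(𝕋¹))} < ∞. Then for every T > 0 and every ε > 0, (∫_{ε²}^{T−ε²} |S^t_ε(g)(t; t/ε²) · S^t_ε(f)(t; t/ε²)|^q dt)^{1/q} ≤ C ‖g‖_{L^{q₁}(0,T; L^{s₁}(𝕋¹))} ‖f‖_{L^{q₂}(0,T; L^{s₂}(𝕋¹))}, where C depends only on q. -/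
open MeasureTheory Set ENNReal

noncomputable section

/-- `L^p` "norm" (in `ℝ≥0∞`) of an `ℝ≥0∞`-valued function, essential-sup for `p = ∞`. -/
def eLp {α : Type*} [MeasurableSpace α] (p : ℝ≥0∞) (μ : Measure α) (f : α → ℝ≥0∞) : ℝ≥0∞ :=
  if p = ∞ then essSup f μ else (∫⁻ x, f x ^ p.toReal ∂μ) ^ (1 / p.toReal)

/-- Smooth nonnegative normalized kernel supported in `(-1/2, 1/2)`. -/
def GoodK1 (φ₁ : ℝ → ℝ) : Prop :=
  ContDiff ℝ (⊤ : ℕ∞) φ₁ ∧ HasCompactSupport φ₁ ∧ tsupport φ₁ ⊆ Ioo (-(1/2) : ℝ) (1/2) ∧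
    (∀ s, 0 ≤ φ₁ s) ∧ (∫ s : ℝ, φ₁ s) = 1

/-- time-smoothing operator `S^t_ε` for functions `g(t;τ)`. -/
def St1 (φ₁ : ℝ → ℝ) (ε : ℝ) (g : ℝ → ℝ → ℝ) : ℝ → ℝ → ℝ :=
  fun t τ => ∫ s : ℝ, g (t - s) τ * ((ε ^ 2)⁻¹ * φ₁ (s / ε ^ 2))

/-- Mixed norm `‖g‖_{L^q(I; L^s(𝕋¹))}`. -/
def tNorm (q s : ℝ≥0∞) (I : Set ℝ) (g : ℝ → ℝ → ℝ) : ℝ≥0∞ :=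
  eLp q (volume.restrict I) fun t =>
    eLp s (volume.restrict (Ioc (0:ℝ) 1)) fun τ => (‖g t τ‖₊ : ℝ≥0∞)


variable {α β : Type*} [MeasurableSpace α] [MeasurableSpace β]

lemma eLp_eq_eLpNorm {p : ℝ≥0∞} (hp : p ≠ 0) (μ : Measure α) (f : α → ℝ≥0∞) :
    eLp p μ f = eLpNorm f p μ := by
  simp only [eLp, eLpNorm, hp, if_false, eLpNormEssSup, eLpNorm', enorm_eq_self]

lemma eLp_mono {p : ℝ≥0∞} {μ : Measure α} {f g : α → ℝ≥0∞} (h : ∀ᵐ x ∂μ, f x ≤ g x) :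
    eLp p μ f ≤ eLp p μ g := by
  unfold eLp
  split_ifs
  · exact essSup_mono_ae h
  · gcongr ?_ ^ _
    refine lintegral_mono_ae ?_
    filter_upwards [h] with x hx
    gcongr

lemma eLp_mul_le {p p₁ p₂ : ℝ≥0∞} (hp : p ≠ 0) (hp' : p ≠ ∞) (h₁ : p₁ ≠ 0) (h₂ : p₂ ≠ 0)
    (h : 1 / p₁ + 1 / p₂ = 1 / p) {μ : Measure α} {f g : α → ℝ≥0∞}
    (hf : Measurable f) (hg : Measurable g) :
    eLp p μ (fun x => f x * g x) ≤ eLp p₁ μ f * eLp p₂ μ g := by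
  have key : ∀ (f g : α → ℝ≥0∞), Measurable g →
      eLp p μ (fun x => f x * g x) ≤ essSup f μ * eLp p μ g := by
    intro f g hg
    have hpos : 0 < p.toReal := ENNReal.toReal_pos hp hp'
    simp only [eLp, hp', if_false]
    calc (∫⁻ x, (f x * g x) ^ p.toReal ∂μ) ^ (1 / p.toReal)
        ≤ (∫⁻ x, essSup f μ ^ p.toReal * g x ^ p.toReal ∂μ) ^ (1 / p.toReal) := by
          gcongr ?_ ^ _
          refine lintegral_mono_ae ?_
          filter_upwards [ENNReal.ae_le_essSup f] with x hx
          rw [ENNReal.mul_rpow_of_nonneg _ _ hpos.le]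
          gcongr
      _ = _ := by
          rw [lintegral_const_mul _ (hg.pow_const _), ENNReal.mul_rpow_of_nonneg _ _ (by positivity),
            ← ENNReal.rpow_mul, mul_one_div_cancel hpos.ne', ENNReal.rpow_one]
  simp only [one_div] at h
  by_cases i₁ : p₁ = ∞
  · obtain rfl : p₂ = p := by simpa [i₁] using h
    simpa [eLp, i₁] using key f g hg
  by_cases i₂ : p₂ = ∞
  · obtain rfl : p₁ = p := by simpa [i₂] using h
    have := key g f hf
    simp only [mul_comm (g _)] at this
    rw [mul_comm]
    simpa [eLp, i₂] using this
  have hR : 1 / p.toReal = 1 / p₁.toReal + 1 / p₂.toReal := by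
    have := congrArg ENNReal.toReal h
    rw [ENNReal.toReal_add (by simpa) (by simpa)] at this
    simp only [ENNReal.toReal_inv] at this
    simp only [one_div, this]
  have hpos : 0 < p.toReal := ENNReal.toReal_pos hp hp'
  have hpos₁ : 0 < p₁.toReal := ENNReal.toReal_pos h₁ i₁
  have hpos₂ : 0 < p₂.toReal := ENNReal.toReal_pos h₂ i₂
  have hlt : p.toReal < p₁.toReal := by
    refine (one_div_lt_one_div hpos₁ hpos).1 ?_
    have : 0 < 1 / p₂.toReal := by positivity
    linarith
  simpa [eLp, hp', i₁, i₂] using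
    ENNReal.lintegral_Lp_mul_le_Lq_mul_Lr hpos hlt hR μ hf.aemeasurable hg.aemeasurable

lemma measurable_eLp {p : ℝ≥0∞} {ν : Measure β} [SFinite ν] {f : α → β → ℝ≥0∞}
    (hf : Measurable (Function.uncurry f)) : Measurable fun x => eLp p ν (f x) := by
  unfold eLp
  split_ifs
  · refine measurable_of_Iic fun c => ?_
    have : (fun x => essSup (f x) ν) ⁻¹' Iic c =
        (fun x => ν (Prod.mk x ⁻¹' {z | c < Function.uncurry f z})) ⁻¹' {0} := by
      ext x
      have : ν {y | c < f x y} = 0 ↔ ∀ᵐ y ∂ν, f x y ≤ c := by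
        simp [ae_iff]
      simp only [mem_preimage, mem_Iic, mem_singleton_iff, preimage_ofPred_eq, Function.uncurry,
        this]
      exact ⟨fun h => (ENNReal.ae_le_essSup _).mono fun y hy => hy.trans h,
        fun h => essSup_le_of_ae_le c h⟩
    rw [this]
    exact measurable_measure_prodMk_left (measurableSet_lt measurable_const hf)
      (measurableSet_singleton 0)
  · exact (Measurable.lintegral_prod_right' (f := fun z => f z.1 z.2 ^ p.toReal)
      (hf.pow_const _)).pow_const _

/-- Minkowski's integral inequality. -/
lemma eLp_lintegral_le {p : ℝ≥0∞} (hp : 1 ≤ p) {μ : Measure α} {ν : Measure β} [SFinite μ]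
    [IsFiniteMeasure ν] {f : α → β → ℝ≥0∞} (hf : Measurable (Function.uncurry f)) :
    eLp p ν (fun y => ∫⁻ x, f x y ∂μ) ≤ ∫⁻ x, eLp p ν (f x) ∂μ := by
  by_cases htop : p = ∞
  · simp only [htop, eLp, if_true]
    refine essSup_le_of_ae_le _ ?_
    have hm : Measurable fun x => essSup (f x) ν := by
      simpa [eLp] using measurable_eLp (p := ∞) (ν := ν) hf
    have h : ∀ᵐ x ∂μ, ∀ᵐ y ∂ν, f x y ≤ essSup (f x) ν :=
      Filter.Eventually.of_forall fun x => ENNReal.ae_le_essSup _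
    rw [Measure.ae_ae_comm (p := fun x y => f x y ≤ essSup (f x) ν)
      (measurableSet_le hf (hm.comp measurable_fst))] at h
    filter_upwards [h] with y hy
    exact lintegral_mono_ae hy
  have hf' : Measurable (Function.uncurry fun y x => f x y) := hf.comp measurable_swap
  set G : β → ℝ≥0∞ := fun y => ∫⁻ x, f x y ∂μ with hG
  have hGm : Measurable G := hf'.lintegral_prod_right
  simp only [eLp, htop, if_false]
  have hp1 : 1 ≤ p.toReal := by
    simpa using ENNReal.toReal_mono htop hp
  generalize p.toReal = r at hp1
  rcases hp1.eq_or_lt with rfl | hr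
  · simp only [ENNReal.rpow_one, div_one]
    exact (lintegral_lintegral_swap hf'.aemeasurable).le
  set I := ∫⁻ x, (∫⁻ y, f x y ^ r ∂ν) ^ (1 / r) ∂μ with hI
  have hr0 : 0 < r := by linarith
  have hconj := Real.HolderConjugate.conjExponent hr
  set r' := r.conjExponent
  have trunc : ∀ n : ℕ, ∫⁻ y, min (G y) n ^ r ∂ν ≤ I ^ r := by
    intro n
    set X := ∫⁻ y, min (G y) n ^ r ∂ν with hX
    have hXtop : X ≠ ∞ := by
      refine ((lintegral_mono fun y => ENNReal.rpow_le_rpow (min_le_right _ _) hr0.le).trans_lt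
        ?_).ne
      rw [lintegral_const]
      exact ENNReal.mul_lt_top (ENNReal.rpow_lt_top_of_nonneg hr0.le (by simp))
        (measure_lt_top _ _)
    have hle : X ≤ I * X ^ (1 / r') := by
      calc X ≤ ∫⁻ y, ∫⁻ x, f x y * min (G y) n ^ (r - 1) ∂μ ∂ν := by
            refine lintegral_mono fun y => ?_
            rw [lintegral_mul_const _ (hf'.of_uncurry_left)]
            calc min (G y) n ^ r = min (G y) n ^ (1 + (r - 1)) := by congr 1; ring
              _ = min (G y) n * min (G y) n ^ (r - 1) := by
                rw [ENNReal.rpow_add_of_nonneg _ _ zero_le_one (by linarith), ENNReal.rpow_one]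
              _ ≤ _ := by gcongr; exact min_le_left _ _
        _ = ∫⁻ x, ∫⁻ y, f x y * min (G y) n ^ (r - 1) ∂ν ∂μ := by
            refine lintegral_lintegral_swap (Measurable.aemeasurable ?_)
            exact hf'.mul (((hGm.comp measurable_fst).min measurable_const).pow_const _)
        _ ≤ ∫⁻ x, (∫⁻ y, f x y ^ r ∂ν) ^ (1 / r) * X ^ (1 / r') ∂μ := by
            refine lintegral_mono fun x => ?_
            refine (ENNReal.lintegral_mul_le_Lp_mul_Lq ν hconj hf.of_uncurry_left.aemeasurable
              ((hGm.min measurable_const).pow_const _).aemeasurable).trans_eq ?_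
            congr 3
            funext y
            rw [← ENNReal.rpow_mul, hconj.sub_one_mul_conj]
        _ = I * X ^ (1 / r') := by
            refine lintegral_mul_const _ ?_
            exact (Measurable.lintegral_prod_right' (f := fun z => f z.1 z.2 ^ r)
              (hf.pow_const _)).pow_const _
    rcases eq_or_ne X 0 with h0 | h0
    · simp [h0]
    have hXX : X = X ^ (1 / r) * X ^ (1 / r') := by
      rw [← ENNReal.rpow_add _ _ h0 hXtop]
      have : 1 / r + 1 / r' = 1 := by simpa using hconj.inv_add_inv_eq_one
      rw [this, ENNReal.rpow_one]
    have hne0 : X ^ (1 / r') ≠ 0 := by simp [ENNReal.rpow_eq_zero_iff, h0, hXtop]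
    have hnet : X ^ (1 / r') ≠ ∞ :=
      ENNReal.rpow_ne_top_of_nonneg (by simpa using hconj.symm.nonneg) hXtop
    have : X ^ (1 / r) ≤ I := by
      rw [hXX] at hle
      exact (ENNReal.mul_le_mul_iff_left hne0 hnet).1 (by rwa [← hXX] at hle ⊢)
    calc X = (X ^ (1 / r)) ^ r := by
          rw [← ENNReal.rpow_mul, one_div_mul_cancel hr0.ne', ENNReal.rpow_one]
      _ ≤ I ^ r := by gcongr
  have hlim : ∫⁻ y, G y ^ r ∂ν ≤ I ^ r := by
    refine le_of_tendsto' (lintegral_tendsto_of_tendsto_of_monotone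
      (f := fun (n : ℕ) y => min (G y) n ^ r) (F := fun y => G y ^ r)
      (fun n => ((hGm.min measurable_const).pow_const _).aemeasurable) ?_ ?_) trunc
    · refine Filter.Eventually.of_forall fun y m n hmn => ?_
      dsimp only
      gcongr
    · refine Filter.Eventually.of_forall fun y => ?_
      refine (ENNReal.continuous_rpow_const.tendsto _).comp ?_
      simpa using tendsto_const_nhds.min ENNReal.tendsto_nat_nhds_top
  calc (∫⁻ y, G y ^ r ∂ν) ^ (1 / r) ≤ (I ^ r) ^ (1 / r) := by gcongr
    _ = I := by rw [← ENNReal.rpow_mul, mul_one_div_cancel hr0.ne', ENNReal.rpow_one]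

/-- Young's inequality for the convolution with the indicator function of an interval. -/
lemma eLp_window_le {p : ℝ≥0∞} (hp : 1 ≤ p) {μ : Measure ℝ} [IsFiniteMeasure μ]
    (hμ : μ ≤ volume) {A : ℝ → ℝ≥0∞} (hA : Measurable A) (δ : ℝ) :
    eLp p μ (fun σ => ∫⁻ u in Ioo (-δ) δ, A (σ - u)) ≤
      ENNReal.ofReal (2 * δ) * eLp p volume A := by
  have hp0 : p ≠ 0 := (zero_lt_one.trans_le hp).ne'
  calc eLp p μ (fun σ => ∫⁻ u in Ioo (-δ) δ, A (σ - u))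
      ≤ ∫⁻ u in Ioo (-δ) δ, eLp p μ (fun σ => A (σ - u)) :=
        eLp_lintegral_le hp (f := fun u σ => A (σ - u))
          (hA.comp (measurable_snd.sub measurable_fst))
    _ ≤ ∫⁻ u in Ioo (-δ) δ, eLp p volume A := by
        refine lintegral_mono fun u => ?_
        rw [eLp_eq_eLpNorm hp0, eLp_eq_eLpNorm hp0]
        refine (eLpNorm_mono_measure _ hμ).trans_eq ?_
        exact eLpNorm_comp_measurePreserving hA.aestronglyMeasurable
          (measurePreserving_sub_right volume u)
    _ = _ := by
        rw [setLIntegral_const, Real.volume_Ioo, mul_comm]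
        ring_nf

lemma setLIntegral_Ioc_periodic_comp_div {H : ℝ → ℝ≥0∞} (hH : Measurable H)
    (hper : ∀ τ, H (τ + 1) = H τ) {δ : ℝ} (hδ : 0 < δ) (a : ℝ) :
    ∫⁻ t in Ioc a (a + δ), H (t / δ) = ENNReal.ofReal δ * ∫⁻ τ in Ioc (0 : ℝ) 1, H τ := by
  have hper' : Function.Periodic (fun t => H (t / δ)) δ := fun t => by
    simp only [add_div, div_self hδ.ne', hper]
  calc ∫⁻ t in Ioc a (a + δ), H (t / δ) = ∫⁻ t in Ioc 0 (0 + δ), H (t / δ) := by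
        refine (isAddFundamentalDomain_Ioc hδ a).setLIntegral_eq
          (isAddFundamentalDomain_Ioc hδ 0) _ ?_
        rintro ⟨_, n, rfl⟩ x
        have := hper'.zsmul n x
        simpa [AddSubgroup.vadd_def, add_comm] using this
    _ = ∫⁻ t in (δ⁻¹ * ·) ⁻¹' Ioc 0 1, H (δ⁻¹ * t) := by
        have : (δ⁻¹ * ·) ⁻¹' Ioc 0 1 = Ioc 0 (0 + δ) := by
          ext t
          simp only [mem_preimage, mem_Ioc, inv_mul_eq_div, zero_add, div_le_one hδ,
            div_pos_iff_of_pos_right hδ]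
        rw [this]
        simp only [inv_mul_eq_div]
    _ = _ := by
        rw [← setLIntegral_map measurableSet_Ioc hH (measurable_const_mul _),
          Real.map_volume_mul_left (inv_ne_zero hδ.ne'), inv_inv, abs_of_pos hδ,
          Measure.restrict_smul, lintegral_smul_measure, smul_eq_mul]

lemma mul_setLIntegral_le_setLIntegral_window {H : ℝ → ℝ≥0∞} (hH : Measurable H) {δ : ℝ}
    (hδ : 0 < δ) (T : ℝ) :
    ENNReal.ofReal δ * ∫⁻ t in Ioc δ (T - δ), H t ≤
      ∫⁻ σ in Ioc 0 T, ∫⁻ t in Ioc (σ - δ / 2) (σ - δ / 2 + δ), H t := by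
  set S : Set (ℝ × ℝ) := {z | z.2 ∈ Ioc (z.1 - δ / 2) (z.1 - δ / 2 + δ)} with hS
  have hSm : MeasurableSet S :=
    (measurableSet_lt (measurable_fst.sub_const _) measurable_snd).inter
      (measurableSet_le measurable_snd ((measurable_fst.sub_const _).add_const _))
  let K : ℝ → ℝ → ℝ≥0∞ := fun σ t => S.indicator (fun z : ℝ × ℝ => H z.2) (σ, t)
  have hK : Measurable (Function.uncurry K) := (hH.comp measurable_snd).indicator hSm
  calc ENNReal.ofReal δ * ∫⁻ t in Ioc δ (T - δ), H t
      = ∫⁻ t in Ioc δ (T - δ), ENNReal.ofReal δ * H t := (lintegral_const_mul _ hH).symm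
    _ ≤ ∫⁻ t in Ioc δ (T - δ), ∫⁻ σ in Ioc 0 T, K σ t := by
        refine setLIntegral_mono' measurableSet_Ioc fun t ht => ?_
        calc ENNReal.ofReal δ * H t = ∫⁻ σ in Ico (t - δ / 2) (t + δ / 2), H t := by
              rw [setLIntegral_const, Real.volume_Ico, mul_comm]
              ring_nf
          _ = ∫⁻ σ in Ico (t - δ / 2) (t + δ / 2), K σ t := by
              refine setLIntegral_congr_fun measurableSet_Ico fun σ hσ => ?_
              have : (σ, t) ∈ S := by
                simp only [hS, mem_ofPred_eq, mem_Ioc, mem_Ico] at hσ ⊢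
                constructor <;> linarith
              exact (indicator_of_mem this fun z : ℝ × ℝ => H z.2).symm
          _ ≤ _ := by
              refine lintegral_mono_set fun σ hσ => ?_
              simp only [mem_Ioc, mem_Ico] at hσ ht ⊢
              constructor <;> linarith
    _ ≤ ∫⁻ t, ∫⁻ σ in Ioc 0 T, K σ t := setLIntegral_le_lintegral _ _
    _ = ∫⁻ σ in Ioc 0 T, ∫⁻ t, K σ t := (lintegral_lintegral_swap hK.aemeasurable).symm
    _ = _ := by
        refine lintegral_congr fun σ => ?_
        rw [← lintegral_indicator measurableSet_Ioc]
        rfl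

/-- The integral of `G` in its first variable over the window of radius `δ` centred at `σ`. -/
def windowLIntegral (δ : ℝ) (G : ℝ → ℝ → ℝ≥0∞) (σ τ : ℝ) : ℝ≥0∞ :=
  ∫⁻ r in Ioo (σ - δ) (σ + δ), G r τ

lemma windowLIntegral_eq (δ : ℝ) (G : ℝ → ℝ → ℝ≥0∞) (σ τ : ℝ) :
    windowLIntegral δ G σ τ = ∫⁻ u in Ioo (-δ) δ, G (σ - u) τ := by
  rw [windowLIntegral, ← lintegral_indicator measurableSet_Ioo,
    ← lintegral_indicator measurableSet_Ioo, ← lintegral_sub_left_eq_self _ σ]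
  refine lintegral_congr fun u => ?_
  have : σ - u ∈ Ioo (σ - δ) (σ + δ) ↔ u ∈ Ioo (-δ) δ := by
    simp only [mem_Ioo]
    constructor <;> rintro ⟨h₁, h₂⟩ <;> constructor <;> linarith
  simp only [indicator, this]

lemma measurable_windowLIntegral (δ : ℝ) {G : ℝ → ℝ → ℝ≥0∞}
    (hG : Measurable (Function.uncurry G)) :
    Measurable (Function.uncurry (windowLIntegral δ G)) := by
  have : Function.uncurry (windowLIntegral δ G) =
      fun z : ℝ × ℝ => ∫⁻ u in Ioo (-δ) δ, Function.uncurry G (z.1 - u, z.2) := by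
    funext z
    exact windowLIntegral_eq δ G z.1 z.2
  rw [this]
  exact Measurable.lintegral_prod_right'
    (f := fun w : (ℝ × ℝ) × ℝ => Function.uncurry G (w.1.1 - w.2, w.1.2))
    (hG.comp (((measurable_fst.comp measurable_fst).sub measurable_snd).prodMk
      (measurable_snd.comp measurable_fst)))

lemma eLp_eLp_windowLIntegral_le {p s : ℝ≥0∞} (hp : 1 ≤ p) (hs : 1 ≤ s) {μ ν : Measure ℝ}
    [IsFiniteMeasure μ] [IsFiniteMeasure ν] (hμ : μ ≤ volume) {G : ℝ → ℝ → ℝ≥0∞}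
    (hG : Measurable (Function.uncurry G)) (δ : ℝ) :
    eLp p μ (fun σ => eLp s ν (windowLIntegral δ G σ)) ≤
      ENNReal.ofReal (2 * δ) * eLp p volume (fun r => eLp s ν (G r)) := by
  refine le_trans (eLp_mono (Filter.Eventually.of_forall fun σ => ?_))
    (eLp_window_le hp hμ (measurable_eLp hG) δ)
  have : windowLIntegral δ G σ = fun τ => ∫⁻ u in Ioo (-δ) δ, G (σ - u) τ :=
    funext (windowLIntegral_eq δ G σ)
  rw [this]
  exact eLp_lintegral_le hs (f := fun u τ => G (σ - u) τ)
    (hG.comp ((measurable_const.sub measurable_fst).prodMk measurable_snd))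

lemma eLp_rpow {p : ℝ≥0∞} (hp : p ≠ 0) (hp' : p ≠ ∞) (μ : Measure α) (f : α → ℝ≥0∞) :
    eLp p μ f ^ p.toReal = ∫⁻ x, f x ^ p.toReal ∂μ := by
  have := (ENNReal.toReal_pos hp hp').ne'
  rw [eLp, if_neg hp', ← ENNReal.rpow_mul, one_div_mul_cancel this, ENNReal.rpow_one]

lemma setLIntegral_window_mul_rpow_le {q q₁ q₂ s₁ s₂ : ℝ≥0∞} (hq : 1 ≤ q) (hq' : q ≠ ∞)
    (hq₁ : 1 ≤ q₁) (hq₂ : 1 ≤ q₂) (hs₁ : 1 ≤ s₁) (hs₂ : 1 ≤ s₂)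
    (hqq : 1 / q₁ + 1 / q₂ = 1 / q) (hss : 1 / s₁ + 1 / s₂ = 1 / q) {G F : ℝ → ℝ → ℝ≥0∞}
    (hG : Measurable (Function.uncurry G)) (hF : Measurable (Function.uncurry F))
    (hGper : ∀ t τ, G t (τ + 1) = G t τ) (hFper : ∀ t τ, F t (τ + 1) = F t τ)
    {δ : ℝ} (hδ : 0 < δ) (T : ℝ) :
    ∫⁻ t in Ioc δ (T - δ),
        (windowLIntegral (δ / 2) G t (t / δ) * windowLIntegral (δ / 2) F t (t / δ)) ^ q.toReal ≤
      ((ENNReal.ofReal (2 * δ) *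
          eLp q₁ volume fun r => eLp s₁ (volume.restrict (Ioc 0 1)) (G r)) *
        (ENNReal.ofReal (2 * δ) *
          eLp q₂ volume fun r => eLp s₂ (volume.restrict (Ioc 0 1)) (F r))) ^ q.toReal := by
  have ne0 : ∀ {p : ℝ≥0∞}, 1 ≤ p → p ≠ 0 := fun h => (zero_lt_one.trans_le h).ne'
  have hGm (d : ℝ) := measurable_windowLIntegral d hG
  have hFm (d : ℝ) := measurable_windowLIntegral d hF
  have hdiag : Measurable fun t : ℝ => (t, t / δ) :=
    measurable_id.prodMk (measurable_id.div_const δ)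
  set ν : Measure ℝ := volume.restrict (Ioc 0 1)
  set μ : Measure ℝ := volume.restrict (Ioc 0 T)
  have hμ : μ ≤ volume := Measure.restrict_le_self
  have hinner : ∀ σ, ∫⁻ t in Ioc (σ - δ / 2) (σ - δ / 2 + δ),
      (windowLIntegral (δ / 2) G t (t / δ) * windowLIntegral (δ / 2) F t (t / δ)) ^ q.toReal ≤
      ENNReal.ofReal δ *
        (eLp s₁ ν (windowLIntegral δ G σ) * eLp s₂ ν (windowLIntegral δ F σ)) ^ q.toReal := by
    intro σ
    have hsub : ∀ t ∈ Ioc (σ - δ / 2) (σ - δ / 2 + δ),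
        Ioo (t - δ / 2) (t + δ / 2) ⊆ Ioo (σ - δ) (σ + δ) := fun t ht r hr => by
      simp only [mem_Ioc, mem_Ioo] at ht hr ⊢
      constructor <;> linarith
    calc _ ≤ ∫⁻ t in Ioc (σ - δ / 2) (σ - δ / 2 + δ),
          (windowLIntegral δ G σ (t / δ) * windowLIntegral δ F σ (t / δ)) ^ q.toReal := by
          refine setLIntegral_mono' measurableSet_Ioc fun t ht => ?_
          gcongr <;> exact lintegral_mono_set (hsub t ht)
      _ = ENNReal.ofReal δ *
          ∫⁻ τ, (windowLIntegral δ G σ τ * windowLIntegral δ F σ τ) ^ q.toReal ∂ν := by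
          refine setLIntegral_Ioc_periodic_comp_div (H := fun τ =>
            (windowLIntegral δ G σ τ * windowLIntegral δ F σ τ) ^ q.toReal)
            (((hGm δ).of_uncurry_left.mul (hFm δ).of_uncurry_left).pow_const _) ?_ hδ _
          intro τ
          simp only [windowLIntegral, hGper, hFper]
      _ ≤ _ := by
          rw [← eLp_rpow (ne0 hq) hq']
          gcongr
          exact eLp_mul_le (ne0 hq) hq' (ne0 hs₁) (ne0 hs₂) hss (hGm δ).of_uncurry_left
            (hFm δ).of_uncurry_left
  have hδ0 : ENNReal.ofReal δ ≠ 0 := by simpa using hδ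
  refine (ENNReal.mul_le_mul_iff_right hδ0 ENNReal.ofReal_ne_top).1 ?_
  refine (mul_setLIntegral_le_setLIntegral_window
    ((((hGm _).comp hdiag).mul ((hFm _).comp hdiag)).pow_const _) hδ T).trans ?_
  refine (lintegral_mono hinner).trans ?_
  rw [lintegral_const_mul' _ _ ENNReal.ofReal_ne_top, ← eLp_rpow (ne0 hq) hq']
  gcongr
  refine (eLp_mul_le (ne0 hq) hq' (ne0 hq₁) (ne0 hq₂) hqq (measurable_eLp (hGm δ))
    (measurable_eLp (hFm δ))).trans ?_
  gcongr
  · exact eLp_eLp_windowLIntegral_le hq₁ hs₁ hμ hG δ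
  · exact eLp_eLp_windowLIntegral_le hq₂ hs₂ hμ hF δ

lemma enorm_St1_le {φ₁ : ℝ → ℝ} (hφ₁ : tsupport φ₁ ⊆ Ioo (-(1/2) : ℝ) (1/2)) {M : ℝ}
    (hM : ∀ s, ‖φ₁ s‖ ≤ M) {ε : ℝ} (hε : 0 < ε) {g : ℝ → ℝ → ℝ}
    (hg : Measurable (Function.uncurry g)) {T t : ℝ} (ht : t ∈ Ioc (ε ^ 2) (T - ε ^ 2)) (τ : ℝ) :
    ‖St1 φ₁ ε g t τ‖ₑ ≤ ENNReal.ofReal (M / ε ^ 2) *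
      windowLIntegral (ε ^ 2 / 2) ((Ioc 0 T).indicator fun r τ => ‖g r τ‖ₑ) t τ := by
  have hδ : 0 < ε ^ 2 := by positivity
  generalize hd : ε ^ 2 = δ at *
  set G : ℝ → ℝ → ℝ≥0∞ := (Ioc 0 T).indicator fun r τ => ‖g r τ‖ₑ with hGdef
  have hGt : ∀ s ∈ Ioo (-(δ / 2)) (δ / 2), G (t - s) τ = ‖g (t - s) τ‖ₑ := fun s hs => by
    have : t - s ∈ Ioc 0 T := by
      simp only [mem_Ioc, mem_Ioo] at ht hs ⊢
      constructor <;> linarith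
    simp only [hGdef, indicator_of_mem this]
  have hgt : Measurable fun s => ‖g (t - s) τ‖ₑ :=
    (hg.comp ((measurable_const.sub measurable_id).prodMk measurable_const)).enorm
  rw [windowLIntegral_eq, setLIntegral_congr_fun measurableSet_Ioo hGt,
    ← lintegral_const_mul _ hgt, ← lintegral_indicator measurableSet_Ioo]
  refine (enorm_integral_le_lintegral_enorm _).trans (lintegral_mono fun s => ?_)
  rw [hd]
  by_cases hs : s ∈ Ioo (-(δ / 2)) (δ / 2)
  · rw [indicator_of_mem hs, enorm_mul, mul_comm]
    gcongr
    rw [← ofReal_norm, norm_mul, norm_inv, Real.norm_of_nonneg hδ.le, div_eq_inv_mul M]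
    gcongr
    exact hM _
  · have : s / δ ∉ tsupport φ₁ := fun h => hs <| by
      have := hφ₁ h
      simp only [mem_Ioo, lt_div_iff₀ hδ, div_lt_iff₀ hδ] at this ⊢
      constructor <;> linarith
    simp [image_eq_zero_of_notMem_tsupport this]

lemma eLp_eLp_indicator {p s : ℝ≥0∞} (hp : p ≠ 0) (hs : s ≠ 0) {I : Set ℝ}
    (hI : MeasurableSet I) (g : ℝ → ℝ → ℝ) :
    (eLp p volume fun r => eLp s (volume.restrict (Ioc 0 1))
      ((I.indicator fun r τ => ‖g r τ‖ₑ) r)) = tNorm p s I g := by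
  have : (fun r => eLp s (volume.restrict (Ioc 0 1)) ((I.indicator fun r τ => ‖g r τ‖ₑ) r)) =
      I.indicator fun r => eLp s (volume.restrict (Ioc 0 1)) fun τ => ‖g r τ‖ₑ := by
    funext r
    by_cases hr : r ∈ I
    · simp [hr]
    · rw [indicator_of_notMem hr, indicator_of_notMem hr, eLp_eq_eLpNorm hs]
      exact eLpNorm_zero'
  rw [this, eLp_eq_eLpNorm hp, eLpNorm_indicator_eq_eLpNorm_restrict hI, ← eLp_eq_eLpNorm hp]
  rfl

theorem stmt_1 (q : ℝ≥0∞) (hq1 : 1 ≤ q) (hq2 : q ≠ ∞)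
    (φ₁ : ℝ → ℝ) (hφ₁ : GoodK1 φ₁) :
    ∃ C : ℝ≥0∞, C ≠ ∞ ∧
      ∀ (q₁ q₂ s₁ s₂ : ℝ≥0∞), 1 ≤ q₁ → 1 ≤ q₂ → 1 ≤ s₁ → 1 ≤ s₂ →
        1/q₁ + 1/q₂ = 1/q → 1/s₁ + 1/s₂ = 1/q →
        ∀ g f : ℝ → ℝ → ℝ,
          Measurable (fun w : ℝ × ℝ => g w.1 w.2) →
          Measurable (fun w : ℝ × ℝ => f w.1 w.2) →
          (∀ t τ, g t (τ + 1) = g t τ) → (∀ t τ, f t (τ + 1) = f t τ) →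
          tNorm q₁ s₁ univ g < ∞ → tNorm q₂ s₂ univ f < ∞ →
          ∀ T : ℝ, 0 < T → ∀ ε : ℝ, 0 < ε →
            eLp q (volume.restrict (Ioc (ε^2) (T - ε^2)))
                (fun t => (‖St1 φ₁ ε g t (t / ε^2) * St1 φ₁ ε f t (t / ε^2)‖₊ : ℝ≥0∞)) ≤
              C * tNorm q₁ s₁ (Ioc 0 T) g * tNorm q₂ s₂ (Ioc 0 T) f := by
  obtain ⟨hsmooth, hcompact, hsupp, -, -⟩ := hφ₁
  obtain ⟨M, hM⟩ := hcompact.exists_bound_of_continuous hsmooth.continuous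
  refine ⟨ENNReal.ofReal (M * 2) * ENNReal.ofReal (M * 2),
    ENNReal.mul_ne_top ENNReal.ofReal_ne_top ENNReal.ofReal_ne_top, ?_⟩
  intro q₁ q₂ s₁ s₂ hq₁ hq₂ hs₁ hs₂ hqq hss g f hg hf hgper hfper _ _ T _ ε hε
  have ne0 : ∀ {p : ℝ≥0∞}, 1 ≤ p → p ≠ 0 := fun h => (zero_lt_one.trans_le h).ne'
  have hδ : 0 < ε ^ 2 := by positivity
  have hM0 : 0 ≤ M := (norm_nonneg _).trans (hM 0)
  have hr : 0 < q.toReal := ENNReal.toReal_pos (ne0 hq1) hq2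
  have hind : ∀ {h : ℝ → ℝ → ℝ}, Measurable (Function.uncurry h) →
      Measurable (Function.uncurry ((Ioc 0 T).indicator fun r τ => ‖h r τ‖ₑ)) := by
    intro h hh
    convert hh.enorm.indicator (measurable_fst measurableSet_Ioc : MeasurableSet
      (Prod.fst ⁻¹' Ioc 0 T : Set (ℝ × ℝ))) using 1
    funext z
    by_cases hz : z.1 ∈ Ioc 0 T <;> simp [Function.uncurry, indicator, hz]
  have hindper : ∀ {h : ℝ → ℝ → ℝ}, (∀ t τ, h t (τ + 1) = h t τ) → ∀ t τ,
      (Ioc 0 T).indicator (fun r τ => ‖h r τ‖ₑ) t (τ + 1) =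
        (Ioc 0 T).indicator (fun r τ => ‖h r τ‖ₑ) t τ := by
    intro h hh t τ
    by_cases ht : t ∈ Ioc 0 T <;> simp [indicator, ht, hh]
  have key := setLIntegral_window_mul_rpow_le hq1 hq2 hq₁ hq₂ hs₁ hs₂ hqq hss (hind hg) (hind hf)
    (hindper hgper) (hindper hfper) hδ T
  rw [eLp_eLp_indicator (ne0 hq₁) (ne0 hs₁) measurableSet_Ioc,
    eLp_eLp_indicator (ne0 hq₂) (ne0 hs₂) measurableSet_Ioc] at key
  set c := ENNReal.ofReal (M / ε ^ 2) with hc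
  have hcc : c * ENNReal.ofReal (2 * ε ^ 2) = ENNReal.ofReal (M * 2) := by
    rw [hc, ← ENNReal.ofReal_mul (by positivity)]
    congr 1
    field_simp
  refine (ENNReal.rpow_le_rpow_iff hr).1 ?_
  rw [eLp_rpow (ne0 hq1) hq2]
  calc ∫⁻ t in Ioc (ε ^ 2) (T - ε ^ 2),
        (‖St1 φ₁ ε g t (t / ε ^ 2) * St1 φ₁ ε f t (t / ε ^ 2)‖₊ : ℝ≥0∞) ^ q.toReal
      ≤ ∫⁻ t in Ioc (ε ^ 2) (T - ε ^ 2), (c * c) ^ q.toReal *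
          (windowLIntegral (ε ^ 2 / 2) ((Ioc 0 T).indicator fun r τ => ‖g r τ‖ₑ) t (t / ε ^ 2) *
            windowLIntegral (ε ^ 2 / 2) ((Ioc 0 T).indicator fun r τ => ‖f r τ‖ₑ) t
              (t / ε ^ 2)) ^ q.toReal := by
        refine setLIntegral_mono' measurableSet_Ioc fun t ht => ?_
        rw [← ENNReal.mul_rpow_of_nonneg _ _ hr.le, ← enorm_eq_nnnorm, enorm_mul,
          mul_mul_mul_comm]
        gcongr
        · exact enorm_St1_le hsupp hM hε hg ht _
        · exact enorm_St1_le hsupp hM hε hf ht _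
    _ ≤ (c * c) ^ q.toReal *
        (ENNReal.ofReal (2 * ε ^ 2) * tNorm q₁ s₁ (Ioc 0 T) g *
          (ENNReal.ofReal (2 * ε ^ 2) * tNorm q₂ s₂ (Ioc 0 T) f)) ^ q.toReal := by
        rw [lintegral_const_mul' _ _ (ENNReal.rpow_ne_top_of_nonneg hr.le
          (ENNReal.mul_ne_top ENNReal.ofReal_ne_top ENNReal.ofReal_ne_top))]
        gcongr
    _ = _ := by
        rw [← ENNReal.mul_rpow_of_nonneg _ _ hr.le, ← hcc]
        congr 1
        ring

end
end

section
/- Let 1 ≤ q < ∞ and 1 ≤ q̌₁, q̌₂ ≤ ∞ with q̌₁ < ∞ and 1/q = 1/q̌₁ + 1/q̌₂, and let s satisfy q ≤ s ≤ q̌₂ and 1/s < 1/2 + 1/q̌₂. Let g : ℝ → ℝ be measurable with finite seminorm [g]_{W^{1/2,q̌₁}(ℝ)} := (∫_ℝ∫_ℝ |g(t₁)−g(t₂)|^{q̌₁}/|t₁−t₂|^{1+q̌₁/2} dt₁dt₂)^{1/q̌₁}, and let f : ℝ×ℝ → ℝ be measurable, 1-periodic in the second variable τ, with ‖f‖_{L^{q̌₂}(ℝ;L^s(𝕋¹))}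 < ∞. Then (∫_ℝ |(g(t) − S^t(g)(t)) · S^t(f)(t; t)|^q dt)^{1/q} ≤ C [g]_{W^{1/2,q̌₁}(ℝ)} ‖f‖_{L^{q̌₂}(ℝ; L^s(𝕋¹))}, where S^t denotes the time-smoothing operator at scale ε = 1 and C depends only on q, q̌₁, q̌₂, s. -/
open MeasureTheory Set ENNReal

noncomputable section

/-- The mass of `u` on the interval of length `δ` centred at `t`. -/
def localMass (δ : ℝ) (u : ℝ → ℝ≥0∞) (t : ℝ) : ℝ≥0∞ :=
  ∫⁻ w in Icc (t - δ / 2) (t + δ / 2), u w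

lemma measurableSet_abs_sub_le (r : ℝ) : MeasurableSet {z : ℝ × ℝ | |z.1 - z.2| ≤ r} :=
  measurableSet_le (by fun_prop) (by fun_prop)

lemma setLIntegral_Icc_eq_lintegral_indicator (δ : ℝ) (F : ℝ → ℝ → ℝ≥0∞) (t : ℝ) :
    ∫⁻ w in Icc (t - δ / 2) (t + δ / 2), F t w =
      ∫⁻ w, {z : ℝ × ℝ | |z.1 - z.2| ≤ δ / 2}.indicator (fun z => F z.1 z.2) (t, w) := by
  rw [← lintegral_indicator measurableSet_Icc]
  refine lintegral_congr fun w => ?_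
  have h : w ∈ Icc (t - δ / 2) (t + δ / 2) ↔ |t - w| ≤ δ / 2 := by
    rw [abs_le, mem_Icc]
    constructor <;> rintro ⟨h1, h2⟩ <;> constructor <;> linarith
  simp only [indicator, h, mem_ofPred_eq]

lemma measurable_setLIntegral_Icc (δ : ℝ) {F : ℝ → ℝ → ℝ≥0∞}
    (hF : Measurable fun z : ℝ × ℝ => F z.1 z.2) :
    Measurable fun t => ∫⁻ w in Icc (t - δ / 2) (t + δ / 2), F t w := by
  simp_rw [setLIntegral_Icc_eq_lintegral_indicator δ F]
  exact (hF.indicator (measurableSet_abs_sub_le _)).lintegral_prod_right'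

lemma measurable_localMass (δ : ℝ) {u : ℝ → ℝ≥0∞} (hu : Measurable u) :
    Measurable (localMass δ u) :=
  measurable_setLIntegral_Icc δ (F := fun _ w => u w) (hu.comp measurable_snd)

/-- Integration over the band `|t - w| ≤ δ / 2` may be carried out in either order. -/
lemma lintegral_setLIntegral_Icc_swap (δ : ℝ) {F : ℝ → ℝ → ℝ≥0∞}
    (hF : Measurable fun z : ℝ × ℝ => F z.1 z.2) :
    ∫⁻ t, ∫⁻ w in Icc (t - δ / 2) (t + δ / 2), F t w =
      ∫⁻ w, ∫⁻ t in Icc (w - δ / 2) (w + δ / 2), F t w := by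
  simp_rw [setLIntegral_Icc_eq_lintegral_indicator δ F,
    setLIntegral_Icc_eq_lintegral_indicator δ fun w t => F t w]
  rw [lintegral_lintegral_swap
    (f := fun t w => {z : ℝ × ℝ | |z.1 - z.2| ≤ δ / 2}.indicator (fun z => F z.1 z.2) (t, w))
    (hF.indicator (measurableSet_abs_sub_le _)).aemeasurable]
  refine lintegral_congr fun w => lintegral_congr fun t => ?_
  simp only [indicator, mem_ofPred_eq, abs_sub_comm t w]

lemma lintegral_localMass (δ : ℝ) {u : ℝ → ℝ≥0∞} (hu : Measurable u) :
    ∫⁻ t, localMass δ u t = ENNReal.ofReal δ * ∫⁻ w, u w := by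
  unfold localMass
  rw [lintegral_setLIntegral_Icc_swap δ (F := fun _ w => u w) (hu.comp measurable_snd),
    ← lintegral_const_mul _ hu]
  refine lintegral_congr fun w => ?_
  rw [setLIntegral_const, Real.volume_Icc, mul_comm]
  ring_nf

lemma lintegral_le_rpow_lintegral_rpow {α : Type*} [MeasurableSpace α] (μ : Measure α)
    [IsProbabilityMeasure μ] {p : ℝ} (hp : 1 ≤ p) {u : α → ℝ≥0∞} (hu : Measurable u) :
    ∫⁻ x, u x ∂μ ≤ (∫⁻ x, u x ^ p ∂μ) ^ (1 / p) := by
  simpa [eLpNorm'] using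
    eLpNorm'_le_eLpNorm'_of_exponent_le one_pos hp μ hu.aestronglyMeasurable

/-- A one-dimensional dilation and reflection about `t`. -/
lemma setLIntegral_comp_sub_mul {ε : ℝ} (hε : 0 < ε) (t : ℝ) {u : ℝ → ℝ≥0∞} (hu : Measurable u) :
    ∫⁻ x in Icc (-(1 / 2) : ℝ) (1 / 2), u (t - ε * x) =
      ENNReal.ofReal ε⁻¹ * localMass ε u t := by
  have h1 : ∫⁻ x in Icc (-(1 / 2) : ℝ) (1 / 2), u (t - ε * x) =
      ∫⁻ x, (Icc (t - ε / 2) (t + ε / 2)).indicator u (t - ε * x) := by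
    rw [← lintegral_indicator measurableSet_Icc]
    refine lintegral_congr fun x => ?_
    by_cases h : x ∈ Icc (-(1 / 2) : ℝ) (1 / 2)
    · rw [indicator_of_mem h, indicator_of_mem]
      constructor <;> nlinarith [h.1, h.2]
    · rw [indicator_of_notMem h, indicator_of_notMem]
      rintro ⟨h3, h4⟩
      refine h ⟨?_, ?_⟩ <;> by_contra! h5 <;> nlinarith
  have hm : Measurable ((Icc (t - ε / 2) (t + ε / 2)).indicator u) :=
    hu.indicator measurableSet_Icc
  rw [h1, localMass, ← lintegral_indicator measurableSet_Icc,
    ← lintegral_sub_left_eq_self ((Icc (t - ε / 2) (t + ε / 2)).indicator u) t,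
    ← lintegral_map (μ := volume) (f := fun y => (Icc (t - ε / 2) (t + ε / 2)).indicator u (t - y))
      (g := fun x => ε * x) (hm.comp (by fun_prop)) (by fun_prop),
    Real.map_volume_mul_left hε.ne', lintegral_smul_measure, abs_of_pos (inv_pos.2 hε), smul_eq_mul]

/-- Weighted averages of `u` at scale `ε` are controlled by `L^p` averages. -/
lemma lintegral_mul_kernel_le {φ : ℝ → ℝ} {M : ℝ} (hM : ∀ x, φ x ≤ M)
    (hsupp : ∀ x, x ∉ Icc (-(1 / 2) : ℝ) (1 / 2) → φ x = 0) {ε p : ℝ} (hε : 0 < ε) (hp : 1 ≤ p)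
    (t : ℝ) {u : ℝ → ℝ≥0∞} (hu : Measurable u) :
    ∫⁻ x, u (t - ε * x) * ENNReal.ofReal (φ x) ≤
      ENNReal.ofReal M *
        (ENNReal.ofReal ε⁻¹ * localMass ε (fun w => u w ^ p) t) ^ (1 / p) := by
  have hm : Measurable fun x => u (t - ε * x) := hu.comp (by fun_prop)
  have : IsProbabilityMeasure (volume.restrict (Icc (-(1 / 2) : ℝ) (1 / 2))) :=
    ⟨by rw [Measure.restrict_apply_univ, Real.volume_Icc]; norm_num⟩
  calc ∫⁻ x, u (t - ε * x) * ENNReal.ofReal (φ x)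
      ≤ ∫⁻ x, (Icc (-(1 / 2) : ℝ) (1 / 2)).indicator
          (fun x => ENNReal.ofReal M * u (t - ε * x)) x := by
        refine lintegral_mono fun x => ?_
        by_cases h : x ∈ Icc (-(1 / 2) : ℝ) (1 / 2)
        · rw [indicator_of_mem h, mul_comm]
          gcongr
          exact hM x
        · simp [hsupp x h]
    _ = ENNReal.ofReal M * ∫⁻ x in Icc (-(1 / 2) : ℝ) (1 / 2), u (t - ε * x) := by
        rw [lintegral_indicator measurableSet_Icc, lintegral_const_mul _ hm]
    _ ≤ _ := by
        gcongr
        refine (lintegral_le_rpow_lintegral_rpow _ hp hm).trans_eq ?_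
        rw [setLIntegral_comp_sub_mul hε t (u := fun w => u w ^ p) (hu.pow_const p)]

/-- The inner integral of the Gagliardo seminorm of order `1/2` and exponent `p`. -/
def gagliardoDensity (p : ℝ) (g : ℝ → ℝ) (z : ℝ) : ℝ≥0∞ :=
  ∫⁻ w, ‖g z - g w‖ₑ ^ p / ENNReal.ofReal (|z - w| ^ (1 + p / 2))

lemma measurable_gagliardoDensity (p : ℝ) {g : ℝ → ℝ} (hg : Measurable g) :
    Measurable (gagliardoDensity p g) := by
  have h : Measurable fun z : ℝ × ℝ =>
      ‖g z.1 - g z.2‖ₑ ^ p / ENNReal.ofReal (|z.1 - z.2| ^ (1 + p / 2)) := by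
    have h1 : Measurable fun z : ℝ × ℝ => g z.1 - g z.2 :=
      (hg.comp measurable_fst).sub (hg.comp measurable_snd)
    have h2 : Measurable fun z : ℝ × ℝ => |z.1 - z.2| := by fun_prop
    exact (h1.enorm.pow_const p).div (h2.pow_const _).ennreal_ofReal
  exact h.lintegral_prod_right'

lemma localMass_enorm_sub_le {p : ℝ} (hp : 1 ≤ p) {g : ℝ → ℝ} (hg : Measurable g) {ε t z : ℝ}
    (hz : |z - t| ≤ ε / 2) :
    localMass ε (fun w => ‖g z - g w‖ₑ ^ p) t ≤
      ENNReal.ofReal (ε ^ (1 + p / 2)) * gagliardoDensity p g z := by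
  have hm : Measurable fun w =>
      ‖g z - g w‖ₑ ^ p / ENNReal.ofReal (|z - w| ^ (1 + p / 2)) := by
    have h2 : Measurable fun w : ℝ => |z - w| := by fun_prop
    exact ((measurable_const.sub hg).enorm.pow_const p).div (h2.pow_const _).ennreal_ofReal
  rw [gagliardoDensity, ← lintegral_const_mul _ hm, localMass]
  refine (setLIntegral_mono (hm.const_mul _) fun w hw => ?_).trans (setLIntegral_le_lintegral _ _)
  rcases eq_or_ne z w with rfl | hzw
  · simp [ENNReal.zero_rpow_of_pos (by linarith : 0 < p)]
  have hpos : 0 < |z - w| := abs_pos.2 (sub_ne_zero.2 hzw)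
  have hle : |z - w| ≤ ε := by
    rw [abs_le] at hz ⊢
    constructor <;> linarith [hw.1, hw.2]
  rw [← mul_div_assoc, ENNReal.le_div_iff_mul_le
    (Or.inl (ENNReal.ofReal_pos.2 (Real.rpow_pos_of_pos hpos _)).ne')
    (Or.inl ENNReal.ofReal_ne_top), mul_comm]
  gcongr

namespace GoodK1

variable {φ : ℝ → ℝ}

lemma eq_zero_of_notMem (hφ : GoodK1 φ) {x : ℝ} (hx : x ∉ Icc (-(1 / 2) : ℝ) (1 / 2)) :
    φ x = 0 :=
  image_eq_zero_of_notMem_tsupport fun h => hx (Ioo_subset_Icc_self (hφ.2.2.1 h))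

lemma integrable (hφ : GoodK1 φ) : Integrable φ :=
  hφ.1.continuous.integrable_of_hasCompactSupport hφ.2.1

lemma enorm_eq (hφ : GoodK1 φ) (x : ℝ) : ‖φ x‖ₑ = ENNReal.ofReal (φ x) :=
  Real.enorm_of_nonneg (hφ.2.2.2.1 x)

lemma exists_bound (hφ : GoodK1 φ) : ∃ M, 0 < M ∧ ∀ x, φ x ≤ M := by
  obtain ⟨C, hC⟩ := hφ.2.1.exists_bound_of_continuous hφ.1.continuous
  exact ⟨max C 1, by positivity,
    fun x => (le_abs_self _).trans ((hC x).trans (le_max_left _ _))⟩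

lemma lintegral_enorm_sub_mul_le (hφ : GoodK1 φ) {M : ℝ} (hM : ∀ x, φ x ≤ M) {p : ℝ}
    (hp : 1 ≤ p) {g : ℝ → ℝ} (hg : Measurable g) {ε t z : ℝ} (hε : 0 < ε)
    (hz : |z - t| ≤ ε / 2) :
    ∫⁻ x, ‖(g z - g (t - ε * x)) * φ x‖ₑ ≤
      ENNReal.ofReal M * (ENNReal.ofReal (ε ^ (p / 2)) * gagliardoDensity p g z) ^ (1 / p) := by
  simp_rw [enorm_mul, hφ.enorm_eq]
  refine (lintegral_mul_kernel_le hM (fun x => hφ.eq_zero_of_notMem) hε hp t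
    (u := fun w => ‖g z - g w‖ₑ) (measurable_const.sub hg).enorm).trans ?_
  refine mul_le_mul_right (ENNReal.rpow_le_rpow ?_ (by positivity)) _
  refine (mul_le_mul_right (localMass_enorm_sub_le hp hg hz) _).trans_eq ?_
  rw [← mul_assoc, ← ENNReal.ofReal_mul (by positivity), Real.rpow_add hε, Real.rpow_one,
    inv_mul_cancel_left₀ hε.ne']

lemma integrable_dilate_mul (hφ : GoodK1 φ) {p : ℝ} (hp : 1 ≤ p) {g : ℝ → ℝ} (hg : Measurable g)
    {ε t : ℝ} (hε : 0 < ε) (ht : gagliardoDensity p g t ≠ ∞) :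
    Integrable fun x => g (t - ε * x) * φ x := by
  obtain ⟨M, -, hM⟩ := hφ.exists_bound
  have hφm : Measurable φ := hφ.1.continuous.measurable
  have hgm : Measurable fun x => g (t - ε * x) := hg.comp (by fun_prop)
  have h1 : Integrable fun x => (g t - g (t - ε * x)) * φ x := by
    refine ⟨((measurable_const.sub hgm).mul hφm).aestronglyMeasurable, ?_⟩
    refine (hφ.lintegral_enorm_sub_mul_le hM hp hg hε (z := t) (by rw [sub_self, abs_zero]; positivity)).trans_lt ?_
    exact ENNReal.mul_lt_top ENNReal.ofReal_lt_top
      (ENNReal.rpow_lt_top_of_nonneg (by positivity)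
        (ENNReal.mul_ne_top ENNReal.ofReal_ne_top ht))
  refine ((hφ.integrable.const_mul (g t)).sub h1).congr (ae_of_all _ fun x => ?_)
  simp only [Pi.sub_apply]
  ring

lemma enorm_sub_integral_le (hφ : GoodK1 φ) {M : ℝ} (hM : ∀ x, φ x ≤ M) {p : ℝ}
    (hp : 1 ≤ p) {g : ℝ → ℝ} (hg : Measurable g) {ε t z : ℝ} (hε : 0 < ε)
    (hz : |z - t| ≤ ε / 2) (hi : Integrable fun x => g (t - ε * x) * φ x) :
    ‖g z - ∫ x, g (t - ε * x) * φ x‖ₑ ≤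
      ENNReal.ofReal M * (ENNReal.ofReal (ε ^ (p / 2)) * gagliardoDensity p g z) ^ (1 / p) := by
  refine le_trans ?_ (hφ.lintegral_enorm_sub_mul_le hM hp hg hε hz)
  have h : g z - ∫ x, g (t - ε * x) * φ x = ∫ x, (g z - g (t - ε * x)) * φ x := by
    simp_rw [sub_mul]
    rw [integral_sub (hφ.integrable.const_mul _) hi, integral_const_mul, hφ.2.2.2.2, mul_one]
  rw [h]
  exact enorm_integral_le_lintegral_enorm _

lemma enorm_integral_sub_integral_le (hφ : GoodK1 φ) {M : ℝ} (hM : ∀ x, φ x ≤ M)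
    {p : ℝ} (hp : 1 ≤ p) {g : ℝ → ℝ} (hg : Measurable g) {ε δ t : ℝ} (hδ : 0 < δ) (hδε : δ ≤ ε)
    (ht : gagliardoDensity p g t ≠ ∞) :
    ‖(∫ x, g (t - δ * x) * φ x) - ∫ x, g (t - ε * x) * φ x‖ₑ ≤
      ENNReal.ofReal M * ENNReal.ofReal M *
        (ENNReal.ofReal (δ⁻¹ * ε ^ (p / 2)) *
          localMass δ (gagliardoDensity p g) t) ^ (1 / p) := by
  have hp0 : 0 < p := by linarith
  have hε : 0 < ε := hδ.trans_le hδε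
  have hiε := hφ.integrable_dilate_mul hp hg hε ht
  have hiδ := hφ.integrable_dilate_mul hp hg hδ ht
  have hH := measurable_gagliardoDensity p hg
  set b := ∫ x, g (t - ε * x) * φ x with hb
  have h : (∫ x, g (t - δ * x) * φ x) - b = ∫ x, (g (t - δ * x) - b) * φ x := by
    simp_rw [sub_mul]
    rw [integral_sub hiδ (hφ.integrable.const_mul _), integral_const_mul, hφ.2.2.2.2, mul_one]
  set u : ℝ → ℝ≥0∞ := fun z =>
    ENNReal.ofReal M * (ENNReal.ofReal (ε ^ (p / 2)) * gagliardoDensity p g z) ^ (1 / p) with hu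
  have hum : Measurable u := ((hH.const_mul _).pow_const _).const_mul _
  have hup : ∀ z, u z ^ p = ENNReal.ofReal M ^ p *
      (ENNReal.ofReal (ε ^ (p / 2)) * gagliardoDensity p g z) := fun z => by
    rw [hu, ENNReal.mul_rpow_of_nonneg _ _ hp0.le, ← ENNReal.rpow_mul, one_div,
      inv_mul_cancel₀ hp0.ne', ENNReal.rpow_one]
  have hmass : localMass δ (fun w => u w ^ p) t = ENNReal.ofReal M ^ p *
      (ENNReal.ofReal (ε ^ (p / 2)) * localMass δ (gagliardoDensity p g) t) := by
    simp_rw [hup]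
    rw [localMass, lintegral_const_mul _ (hH.const_mul _), lintegral_const_mul _ hH, localMass]
  rw [h]
  calc ‖∫ x, (g (t - δ * x) - b) * φ x‖ₑ
      ≤ ∫⁻ x, ‖(g (t - δ * x) - b) * φ x‖ₑ := enorm_integral_le_lintegral_enorm _
    _ ≤ ∫⁻ x, u (t - δ * x) * ENNReal.ofReal (φ x) := by
        refine lintegral_mono fun x => ?_
        rw [enorm_mul, hφ.enorm_eq]
        by_cases hx : x ∈ Icc (-(1 / 2) : ℝ) (1 / 2)
        · gcongr
          refine hφ.enorm_sub_integral_le hM hp hg hε ?_ hiε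
          rw [sub_sub_cancel_left, abs_neg, abs_mul, abs_of_pos hδ]
          nlinarith [abs_le.2 hx, abs_nonneg x]
        · simp [hφ.eq_zero_of_notMem hx]
    _ ≤ ENNReal.ofReal M * (ENNReal.ofReal δ⁻¹ * localMass δ (fun w => u w ^ p) t) ^ (1 / p) :=
        lintegral_mul_kernel_le hM (fun x => hφ.eq_zero_of_notMem) hδ hp t hum
    _ = _ := by
        rw [hmass, mul_left_comm, ENNReal.mul_rpow_of_nonneg _ _ (by positivity),
          ← ENNReal.rpow_mul, mul_one_div_cancel hp0.ne', ENNReal.rpow_one, ← mul_assoc,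
          ← mul_assoc (ENNReal.ofReal δ⁻¹), ← ENNReal.ofReal_mul (inv_nonneg.2 hδ.le)]

/-- Telescoping over dyadic scales controls the distance of `g` from its mollification. -/
lemma enorm_sub_mollify_le (hφ : GoodK1 φ) {M : ℝ} (hM : ∀ x, φ x ≤ M)
    {p : ℝ} (hp : 1 ≤ p) {g : ℝ → ℝ} (hg : Measurable g) {t : ℝ}
    (ht : gagliardoDensity p g t ≠ ∞) :
    ‖g t - ∫ x, g (t - x) * φ x‖ₑ ≤
      ∑' n : ℕ, ENNReal.ofReal M * ENNReal.ofReal M *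
        (ENNReal.ofReal (((1 / 2 : ℝ) ^ (n + 1))⁻¹ * ((1 / 2 : ℝ) ^ n) ^ (p / 2)) *
          localMass ((1 / 2) ^ (n + 1)) (gagliardoDensity p g) t) ^ (1 / p) := by
  have hp0 : 0 < p := by linarith
  set a : ℕ → ℝ≥0∞ := fun n => ENNReal.ofReal M * ENNReal.ofReal M *
        (ENNReal.ofReal (((1 / 2 : ℝ) ^ (n + 1))⁻¹ * ((1 / 2 : ℝ) ^ n) ^ (p / 2)) *
          localMass ((1 / 2) ^ (n + 1)) (gagliardoDensity p g) t) ^ (1 / p) with ha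
  set b : ℕ → ℝ := fun n => ∫ x, g (t - (1 / 2 : ℝ) ^ n * x) * φ x with hb
  have hb0 : ∫ x, g (t - x) * φ x = b 0 := by simp [hb]
  have hstep : ∀ n, ‖b (n + 1) - b n‖ₑ ≤ a n := fun n =>
    hφ.enorm_integral_sub_integral_le hM hp hg (by positivity)
      (pow_le_pow_of_le_one (by norm_num) (by norm_num) n.le_succ) ht
  have hsum : ∀ N, ‖b N - b 0‖ₑ ≤ ∑ n ∈ Finset.range N, a n := fun N => by
    rw [← Finset.sum_range_sub]
    exact (enorm_sum_le _ _).trans (Finset.sum_le_sum fun n _ => hstep n)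
  have hbd : ∀ N, ‖g t - b 0‖ₑ ≤ ENNReal.ofReal M *
      (ENNReal.ofReal (((1 / 2 : ℝ) ^ N) ^ (p / 2)) * gagliardoDensity p g t) ^ (1 / p) +
        ∑' n, a n := fun N => by
    rw [← sub_add_sub_cancel (g t) (b N) (b 0)]
    refine (enorm_add_le _ _).trans (add_le_add ?_ ((hsum N).trans (ENNReal.sum_le_tsum _)))
    exact hφ.enorm_sub_integral_le hM hp hg (by positivity)
      (by rw [sub_self, abs_zero]; positivity)
      (hφ.integrable_dilate_mul hp hg (by positivity) ht)
  have h1 : Filter.Tendsto (fun N : ℕ => ((1 / 2 : ℝ) ^ N) ^ (p / 2)) Filter.atTop (nhds 0) := by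
    have := (tendsto_pow_atTop_nhds_zero_of_lt_one (r := (1 / 2 : ℝ)) (by norm_num)
      (by norm_num)).rpow_const (p := p / 2) (Or.inr (by positivity))
    rwa [Real.zero_rpow (by positivity)] at this
  have h2 := ENNReal.Tendsto.mul_const (ENNReal.tendsto_ofReal h1)
    (b := gagliardoDensity p g t) (Or.inr ht)
  have h3 := ENNReal.Tendsto.const_mul (h2.ennrpow_const (1 / p)) (a := ENNReal.ofReal M)
    (Or.inr ENNReal.ofReal_ne_top)
  have h4 := h3.add_const (∑' n, a n)
  rw [ENNReal.ofReal_zero, zero_mul, ENNReal.zero_rpow_of_pos (by positivity), mul_zero,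
    zero_add] at h4
  rw [hb0]
  exact ge_of_tendsto' h4 hbd

end GoodK1

lemma eLp_of_ne_top {α : Type*} [MeasurableSpace α] {p : ℝ≥0∞} (hp : p ≠ ∞) (μ : Measure α)
    (f : α → ℝ≥0∞) : eLp p μ f = (∫⁻ x, f x ^ p.toReal ∂μ) ^ (1 / p.toReal) :=
  if_neg hp

lemma eLp_top {α : Type*} [MeasurableSpace α] (μ : Measure α) (f : α → ℝ≥0∞) :
    eLp ∞ μ f = essSup f μ :=
  if_pos rfl

/-- Hölder's inequality with one finite exponent `a` and one possibly infinite exponent `b`. -/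
lemma lintegral_mul_rpow_le_eLp {α : Type*} [MeasurableSpace α] (μ : Measure α) {q a : ℝ}
    {b : ℝ≥0∞} (hq : 1 ≤ q) (ha : 0 < a) (hb : 1 ≤ b) (h : 1 / q = 1 / a + (1 / b).toReal)
    {F G : α → ℝ≥0∞} (hF : Measurable F) (hG : b ≠ ∞ → Measurable G) :
    ∫⁻ x, (F x * G x) ^ q ∂μ ≤ ((∫⁻ x, F x ^ a ∂μ) ^ (1 / a) * eLp b μ G) ^ q := by
  have hq0 : 0 < q := by linarith
  by_cases hbt : b = ∞
  · subst hbt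
    have haq : a = q := by simpa using h.symm
    subst haq
    rw [eLp_top, ENNReal.mul_rpow_of_nonneg _ _ ha.le, ← ENNReal.rpow_mul,
      one_div_mul_cancel ha.ne', ENNReal.rpow_one, ← lintegral_mul_const _ (hF.pow_const a)]
    refine lintegral_mono_ae ?_
    filter_upwards [ENNReal.ae_le_essSup G] with x hx
    rw [← ENNReal.mul_rpow_of_nonneg _ _ ha.le]
    gcongr
  · have hb0 : 0 < b.toReal := ENNReal.toReal_pos (by positivity) hbt
    rw [ENNReal.toReal_div, ENNReal.toReal_one] at h
    have hqa : q < a := by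
      have : 0 < 1 / b.toReal := by positivity
      rw [← one_div_lt_one_div ha hq0]
      linarith
    have := ENNReal.lintegral_Lp_mul_le_Lq_mul_Lr hq0 hqa h μ hF.aemeasurable
      (hG hbt).aemeasurable
    rw [eLp_of_ne_top hbt, ← ENNReal.rpow_inv_le_iff hq0, ← one_div]
    exact this

/-- Interpolation between `L^1` and `L^∞` bounds on `D`, combined with Hölder's inequality. -/
lemma lintegral_rpow_mul_rpow_le {α : Type*} [MeasurableSpace α] (μ : Measure α) {p q ρ : ℝ}
    {s δ E : ℝ≥0∞} (hp : 1 ≤ p) (hq : 1 ≤ q) (hs : 1 ≤ s) (hρ0 : 0 ≤ ρ) (hρp : ρ ≤ 1 / p)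
    (hρ : 1 / q = ρ + (1 / s).toReal) {D Φ : α → ℝ≥0∞} (hD : Measurable D) (hΦ : Measurable Φ)
    (hDE : ∀ᵐ x ∂μ, D x ≤ E) (hDint : ∫⁻ x, D x ∂μ ≤ δ * E) :
    ∫⁻ x, (D x ^ (1 / p) * Φ x) ^ q ∂μ ≤ (δ ^ ρ * E ^ (1 / p) * eLp s μ Φ) ^ q := by
  have hp0 : 0 < p := by linarith
  have hq0 : 0 < q := by linarith
  rcases hρ0.eq_or_lt with rfl | hρpos
  · have hst : s ≠ ∞ := by
      rintro rfl
      simp at hρ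
      linarith
    have hsq : s.toReal = q := by
      rw [ENNReal.toReal_div, ENNReal.toReal_one, zero_add] at hρ
      simpa using hρ.symm
    rw [ENNReal.rpow_zero, one_mul, eLp_of_ne_top hst, hsq,
      ENNReal.mul_rpow_of_nonneg _ _ hq0.le, ← ENNReal.rpow_mul _ (1 / q),
      one_div_mul_cancel hq0.ne', ENNReal.rpow_one, ← lintegral_const_mul _ (hΦ.pow_const q)]
    refine lintegral_mono_ae ?_
    filter_upwards [hDE] with x hx
    rw [← ENNReal.mul_rpow_of_nonneg _ _ hq0.le]
    gcongr
  · set r := 1 / ρ with hr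
    have hr0 : 0 < r := by positivity
    have h1r : 1 / r = ρ := by rw [hr, one_div_one_div]
    have hrp : 1 ≤ r / p := by
      rw [hr, le_div_iff₀ hp0, one_mul, le_one_div hp0 hρpos]
      exact hρp
    refine (lintegral_mul_rpow_le_eLp μ hq hr0 hs (by rw [h1r, hρ]) (hD.pow_const _)
      fun _ => hΦ).trans ?_
    gcongr
    have hsplit : ∀ y : ℝ≥0∞, y ^ (r / p) = y ^ (r / p - 1) * y := fun y => by
      conv_rhs => rw [← ENNReal.rpow_one y, ← ENNReal.rpow_mul, one_mul]
      rw [← ENNReal.rpow_add_of_nonneg _ _ (by linarith) zero_le_one, sub_add_cancel]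
    have key : ∫⁻ x, (D x ^ (1 / p)) ^ r ∂μ ≤ δ * E ^ (r / p) := by
      calc ∫⁻ x, (D x ^ (1 / p)) ^ r ∂μ
          ≤ ∫⁻ x, E ^ (r / p - 1) * D x ∂μ := by
            refine lintegral_mono_ae ?_
            filter_upwards [hDE] with x hx
            rw [← ENNReal.rpow_mul, one_div_mul_eq_div, hsplit]
            gcongr
        _ ≤ E ^ (r / p - 1) * (δ * E) := by
            rw [lintegral_const_mul _ hD]
            gcongr
        _ = δ * E ^ (r / p) := by rw [hsplit]; ring
    calc (∫⁻ x, (D x ^ (1 / p)) ^ r ∂μ) ^ (1 / r)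
        ≤ (δ * E ^ (r / p)) ^ (1 / r) := by gcongr
      _ = δ ^ ρ * E ^ (1 / p) := by
          rw [ENNReal.mul_rpow_of_nonneg _ _ (by positivity), ← ENNReal.rpow_mul, h1r, ← h1r]
          congr 2
          field_simp

lemma eLp_restrict_Ioc_eq_of_periodic (s : ℝ≥0∞) {F : ℝ → ℝ≥0∞} (hF : ∀ x, F (x + 1) = F x)
    (a b : ℝ) :
    eLp s (volume.restrict (Ioc a (a + 1))) F = eLp s (volume.restrict (Ioc b (b + 1))) F := by
  have hinv : ∀ (γ : AddSubgroup.zmultiples (1 : ℝ)) (x : ℝ), F (γ +ᵥ x) = F x :=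
    Function.Periodic.map_vadd_zmultiples hF
  have ha := isAddFundamentalDomain_Ioc one_pos a
  have hb := isAddFundamentalDomain_Ioc one_pos b
  by_cases hs : s = ∞
  · rw [hs, eLp_top, eLp_top, ha.essSup_measure_restrict hinv, hb.essSup_measure_restrict hinv]
  · rw [eLp_of_ne_top hs, eLp_of_ne_top hs,
      ha.setLIntegral_eq hb _ fun γ x => by rw [hinv]]

/-- The space-time estimate at a single scale `δ`. -/
lemma lintegral_localMass_rpow_mul_le {p q ρ δ : ℝ} {s r : ℝ≥0∞} (hp : 1 ≤ p) (hq : 1 ≤ q)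
    (hs : 1 ≤ s) (hsr : s ≤ r) (hρ0 : 0 ≤ ρ) (hρp : ρ ≤ 1 / p)
    (hρ : 1 / q = ρ + (1 / s).toReal) (hr : 1 / q = 1 / p + (1 / r).toReal) (hδ : δ ≤ 1)
    {H : ℝ → ℝ≥0∞} (hH : Measurable H) {Φ : ℝ → ℝ → ℝ≥0∞}
    (hΦ : Measurable fun z : ℝ × ℝ => Φ z.1 z.2) (hper : ∀ t τ, Φ t (τ + 1) = Φ t τ) :
    ∫⁻ t, ∫⁻ w in Icc (t - 1 / 2) (t + 1 / 2), (localMass δ H t ^ (1 / p) * Φ w t) ^ q ≤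
      (ENNReal.ofReal δ ^ ρ * (ENNReal.ofReal 2 * ∫⁻ x, H x) ^ (1 / p) *
        eLp r volume fun t => eLp s (volume.restrict (Ioc 0 1)) (Φ t)) ^ q := by
  have hp0 : 0 < p := by linarith
  have hq0 : 0 < q := by linarith
  have hD := measurable_localMass δ hH
  have hΦt : ∀ w, Measurable (Φ w) := fun w => hΦ.comp measurable_prodMk_left
  set A : ℝ → ℝ≥0∞ := fun t => eLp s (volume.restrict (Ioc 0 1)) (Φ t) with hA
  rw [lintegral_setLIntegral_Icc_swap 1 (F := fun t w => (localMass δ H t ^ (1 / p) * Φ w t) ^ q)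
    ((((hD.comp measurable_fst).pow_const _).mul (hΦ.comp measurable_swap)).pow_const q)]
  have hin : ∀ w, ∫⁻ t in Icc (w - 1 / 2) (w + 1 / 2), (localMass δ H t ^ (1 / p) * Φ w t) ^ q ≤
      (ENNReal.ofReal δ ^ ρ * localMass 2 H w ^ (1 / p) * A w) ^ q := fun w => by
    have hAw : A w = eLp s (volume.restrict (Ioc (w - 1 / 2) (w + 1 / 2))) (Φ w) := by
      have := eLp_restrict_Ioc_eq_of_periodic s (hper w) 0 (w - 1 / 2)
      rw [zero_add, show w - 1 / 2 + 1 = w + 1 / 2 by ring] at this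
      exact this
    have hsub : ∀ t ∈ Ioc (w - 1 / 2) (w + 1 / 2),
        Icc (t - δ / 2) (t + δ / 2) ⊆ Icc (w - 2 / 2) (w + 2 / 2) := fun t ht =>
      Icc_subset_Icc (by linarith [ht.1]) (by linarith [ht.2])
    rw [← restrict_Ioc_eq_restrict_Icc, hAw]
    refine lintegral_rpow_mul_rpow_le _ hp hq hs hρ0 hρp hρ hD (hΦt w) ?_ ?_
    · filter_upwards [ae_restrict_mem measurableSet_Ioc] with t ht
      exact lintegral_mono_set (hsub t ht)
    · calc ∫⁻ t in Ioc (w - 1 / 2) (w + 1 / 2), localMass δ H t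
          ≤ ∫⁻ t in Ioc (w - 1 / 2) (w + 1 / 2),
              localMass δ ((Icc (w - 2 / 2) (w + 2 / 2)).indicator H) t := by
            refine setLIntegral_mono' measurableSet_Ioc fun t ht => ?_
            refine setLIntegral_mono' measurableSet_Icc fun x hx => ?_
            rw [indicator_of_mem (hsub t ht hx)]
        _ ≤ ∫⁻ t, localMass δ ((Icc (w - 2 / 2) (w + 2 / 2)).indicator H) t :=
            setLIntegral_le_lintegral _ _
        _ = ENNReal.ofReal δ * localMass 2 H w := by
            rw [lintegral_localMass _ (hH.indicator measurableSet_Icc),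
              lintegral_indicator measurableSet_Icc, localMass]
  have hAm : r ≠ ∞ → Measurable A := fun hrt => by
    have hst : s ≠ ∞ := ne_top_of_le_ne_top hrt hsr
    simp_rw [hA, eLp_of_ne_top hst]
    exact ((hΦ.pow_const s.toReal).lintegral_prod_right').pow_const _
  calc ∫⁻ w, ∫⁻ t in Icc (w - 1 / 2) (w + 1 / 2), (localMass δ H t ^ (1 / p) * Φ w t) ^ q
      ≤ ∫⁻ w, (ENNReal.ofReal δ ^ ρ * localMass 2 H w ^ (1 / p) * A w) ^ q := lintegral_mono hin
    _ = (ENNReal.ofReal δ ^ ρ) ^ q * ∫⁻ w, (localMass 2 H w ^ (1 / p) * A w) ^ q := by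
        rw [← lintegral_const_mul' _ _ (ENNReal.rpow_ne_top_of_nonneg hq0.le
          (ENNReal.rpow_ne_top_of_nonneg hρ0 ENNReal.ofReal_ne_top))]
        refine lintegral_congr fun w => ?_
        rw [mul_assoc, ENNReal.mul_rpow_of_nonneg _ _ hq0.le]
    _ ≤ (ENNReal.ofReal δ ^ ρ) ^ q *
          ((∫⁻ w, (localMass 2 H w ^ (1 / p)) ^ p) ^ (1 / p) * eLp r volume A) ^ q := by
        gcongr
        exact lintegral_mul_rpow_le_eLp volume hq hp0 (hs.trans hsr) hr
          ((measurable_localMass 2 hH).pow_const _) hAm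
    _ = _ := by
        simp_rw [← ENNReal.rpow_mul, one_div_mul_cancel hp0.ne', ENNReal.rpow_one]
        rw [lintegral_localMass 2 hH, ENNReal.rpow_mul, ← ENNReal.mul_rpow_of_nonneg _ _ hq0.le,
          mul_assoc]

/-- Geometrically decaying `L^q` bounds may be summed. -/
lemma exists_lintegral_tsum_rpow_le {q y : ℝ} (hq : 1 ≤ q) (hy0 : 0 < y) (hy1 : y < 1) :
    ∃ C : ℝ≥0∞, C ≠ ∞ ∧ ∀ (a : ℕ → ℝ → ℝ≥0∞) (X : ℝ≥0∞), (∀ n, Measurable (a n)) →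
      (∀ n, ∫⁻ t, a n t ^ q ≤ (ENNReal.ofReal (y ^ n) * X) ^ q) →
      ∫⁻ t, (∑' n, a n t) ^ q ≤ (C * X) ^ q := by
  have hq0 : 0 < q := by linarith
  set x := √y with hx
  have hx0 : 0 < x := Real.sqrt_pos.2 hy0
  have hx1 : x < 1 := by rw [hx, Real.sqrt_lt' one_pos]; linarith
  have hxx : x * x = y := Real.mul_self_sqrt hy0.le
  set w : ℕ → ℝ≥0∞ := fun n => ENNReal.ofReal (x ^ n) with hw
  have hw0 : ∀ n, w n ≠ 0 := fun n => (ENNReal.ofReal_pos.2 (by positivity)).ne'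
  have hwt : ∀ n, w n ≠ ∞ := fun n => ENNReal.ofReal_ne_top
  have hwy : ∀ n, (w n)⁻¹ * ENNReal.ofReal (y ^ n) = w n := fun n => by
    rw [← hxx, mul_pow, ENNReal.ofReal_mul (by positivity),
      ENNReal.inv_mul_cancel_left (hw0 n) (hwt n)]
  have hsum : ∀ z : ℝ, 0 < z → z < 1 → ∑' n : ℕ, ENNReal.ofReal (z ^ n) ≠ ∞ := fun z h0 h1 =>
    (summable_geometric_of_lt_one h0.le h1).tsum_ofReal_ne_top
  have hwq : ∑' n, w n ^ q ≠ ∞ := by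
    have : ∀ n, w n ^ q = ENNReal.ofReal ((x ^ q) ^ n) := fun n => by
      rw [hw, ENNReal.ofReal_rpow_of_nonneg (by positivity) hq0.le, ← Real.rpow_natCast_mul hx0.le,
        mul_comm, Real.rpow_mul_natCast hx0.le]
    simp_rw [this]
    exact hsum _ (by positivity) (Real.rpow_lt_one hx0.le hx1 hq0)
  refine ⟨(∑' n, w n) * (∑' n, w n ^ q) ^ (1 / q),
    ENNReal.mul_ne_top (hsum x hx0 hx1) (ENNReal.rpow_ne_top_of_nonneg (by positivity) hwq),
    fun a X ha h => ?_⟩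
  have hpt : ∀ t, (∑' n, a n t) ^ q ≤ (∑' n, w n) ^ q * ∑' n, ((w n)⁻¹ * a n t) ^ q := fun t => by
    have h1 : ∀ n, a n t ≤ w n * (∑' n, ((w n)⁻¹ * a n t) ^ q) ^ (1 / q) := fun n => by
      have h2 : (w n)⁻¹ * a n t ≤ (∑' n, ((w n)⁻¹ * a n t) ^ q) ^ (1 / q) := by
        rw [one_div, ENNReal.le_rpow_inv_iff hq0]
        exact ENNReal.le_tsum n
      calc a n t = w n * ((w n)⁻¹ * a n t) := (ENNReal.mul_inv_cancel_left (hw0 n) (hwt n)).symm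
        _ ≤ _ := by gcongr
    calc (∑' n, a n t) ^ q
        ≤ (∑' n, w n * (∑' n, ((w n)⁻¹ * a n t) ^ q) ^ (1 / q)) ^ q := by
          gcongr with n
          exact h1 n
      _ = _ := by
          rw [ENNReal.tsum_mul_right, ENNReal.mul_rpow_of_nonneg _ _ hq0.le, ← ENNReal.rpow_mul,
            one_div_mul_cancel hq0.ne', ENNReal.rpow_one]
  calc ∫⁻ t, (∑' n, a n t) ^ q
      ≤ ∫⁻ t, (∑' n, w n) ^ q * ∑' n, ((w n)⁻¹ * a n t) ^ q := lintegral_mono hpt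
    _ = (∑' n, w n) ^ q * ∑' n, ((w n)⁻¹) ^ q * ∫⁻ t, a n t ^ q := by
        rw [lintegral_const_mul' _ _ (ENNReal.rpow_ne_top_of_nonneg hq0.le (hsum x hx0 hx1)),
          lintegral_tsum fun n => (((ha n).const_mul _).pow_const q).aemeasurable]
        congr 1
        refine tsum_congr fun n => ?_
        rw [← lintegral_const_mul _ ((ha n).pow_const q)]
        exact lintegral_congr fun t => ENNReal.mul_rpow_of_nonneg _ _ hq0.le
    _ ≤ (∑' n, w n) ^ q * ∑' n, w n ^ q * X ^ q := by
        refine mul_le_mul_right (ENNReal.tsum_le_tsum fun n => ?_) _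
        calc ((w n)⁻¹) ^ q * ∫⁻ t, a n t ^ q
            ≤ ((w n)⁻¹) ^ q * (ENNReal.ofReal (y ^ n) * X) ^ q := by gcongr; exact h n
          _ = w n ^ q * X ^ q := by
            rw [← ENNReal.mul_rpow_of_nonneg _ _ hq0.le, ← mul_assoc, hwy,
              ENNReal.mul_rpow_of_nonneg _ _ hq0.le]
    _ = _ := by
        rw [ENNReal.tsum_mul_right, ENNReal.mul_rpow_of_nonneg _ _ hq0.le,
          ENNReal.mul_rpow_of_nonneg _ _ hq0.le, ← ENNReal.rpow_mul,
          one_div_mul_cancel hq0.ne', ENNReal.rpow_one, mul_assoc]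

theorem stmt_6 (q qc₁ qc₂ s : ℝ≥0∞)
    (hq1 : 1 ≤ q) (hq2 : q ≠ ∞) (hqc₁ : 1 ≤ qc₁) (hqc₁' : qc₁ ≠ ∞) (hqc₂ : 1 ≤ qc₂)
    (hsum : 1/q = 1/qc₁ + 1/qc₂) (hs1 : q ≤ s) (hs2 : s ≤ qc₂) (hs3 : 1/s < 1/2 + 1/qc₂)
    (φ₁ : ℝ → ℝ) (hφ₁ : GoodK1 φ₁) :
    ∃ C : ℝ≥0∞, C ≠ ∞ ∧
      ∀ (g : ℝ → ℝ) (f : ℝ → ℝ → ℝ),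
        Measurable g → Measurable (fun w : ℝ × ℝ => f w.1 w.2) →
        (∀ t τ, f t (τ + 1) = f t τ) →
        (∫⁻ t₁ : ℝ, ∫⁻ t₂ : ℝ,
            (‖g t₁ - g t₂‖₊ : ℝ≥0∞) ^ qc₁.toReal /
              ENNReal.ofReal (|t₁ - t₂| ^ (1 + qc₁.toReal / 2))) ^ (1 / qc₁.toReal) < ∞ →
        eLp qc₂ volume
            (fun t => eLp s (volume.restrict (Ioc (0:ℝ) 1)) fun τ => (‖f t τ‖₊ : ℝ≥0∞)) < ∞ →
        eLp q volume
            (fun t => (‖(g t - ∫ σ : ℝ, g (t - σ) * φ₁ σ) *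
                (∫ σ : ℝ, f (t - σ) t * φ₁ σ)‖₊ : ℝ≥0∞)) ≤
          C * (∫⁻ t₁ : ℝ, ∫⁻ t₂ : ℝ,
                (‖g t₁ - g t₂‖₊ : ℝ≥0∞) ^ qc₁.toReal /
                  ENNReal.ofReal (|t₁ - t₂| ^ (1 + qc₁.toReal / 2))) ^ (1 / qc₁.toReal) *
            eLp qc₂ volume
              (fun t => eLp s (volume.restrict (Ioc (0:ℝ) 1)) fun τ => (‖f t τ‖₊ : ℝ≥0∞)) := by
  obtain ⟨M, hM0, hM⟩ := hφ₁.exists_bound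
  have hqc₁0 : qc₁ ≠ 0 := (zero_lt_one.trans_le hqc₁).ne'
  have hqc₂0 : qc₂ ≠ 0 := (zero_lt_one.trans_le hqc₂).ne'
  have hs1' : 1 ≤ s := hq1.trans hs1
  have hs0 : s ≠ 0 := (zero_lt_one.trans_le hs1').ne'
  have hp : 1 ≤ qc₁.toReal := by simpa using ENNReal.toReal_mono hqc₁' hqc₁
  have hq : 1 ≤ q.toReal := by simpa using ENNReal.toReal_mono hq2 hq1
  have hr : 1 / q.toReal = 1 / qc₁.toReal + (1 / qc₂).toReal := by
    have := congrArg ENNReal.toReal hsum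
    rwa [ENNReal.toReal_add (by simp [hqc₁0]) (by simp [hqc₂0]), ENNReal.toReal_div,
      ENNReal.toReal_div 1 qc₁, ENNReal.toReal_one] at this
  have hsr : (1 / qc₂).toReal ≤ (1 / s).toReal :=
    ENNReal.toReal_mono (by simp [hs0]) (by gcongr)
  have hsq : (1 / s).toReal ≤ 1 / q.toReal := by
    rw [← ENNReal.toReal_one, ← ENNReal.toReal_div]
    exact ENNReal.toReal_mono (by simp [(zero_lt_one.trans_le hq1).ne']) (by gcongr)
  have hsγ : (1 / s).toReal < 1 / 2 + (1 / qc₂).toReal := by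
    have := ENNReal.toReal_strict_mono
      (ENNReal.add_ne_top.2 ⟨by simp, by simp [hqc₂0]⟩) hs3
    rwa [ENNReal.toReal_add (by simp) (by simp [hqc₂0]), ENNReal.toReal_div 1 2,
      ENNReal.toReal_one, ENNReal.toReal_ofNat] at this
  set p := qc₁.toReal with hpdef
  set e := q.toReal with hedef
  have hp0 : 0 < p := by linarith
  have he0 : 0 < e := by linarith
  obtain ⟨ρ, hρ⟩ : ∃ ρ, 1 / e = ρ + (1 / s).toReal := ⟨1 / e - (1 / s).toReal, by ring⟩
  have hρ0 : 0 ≤ ρ := by linarith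
  have hρp : ρ ≤ 1 / p := by linarith
  set γ := 1 / 2 + ρ - 1 / p with hγ
  have hγ0 : 0 < γ := by linarith
  obtain ⟨C, hC, hCsum⟩ := exists_lintegral_tsum_rpow_le hq
    (Real.rpow_pos_of_pos (by norm_num : (0 : ℝ) < 1 / 2) γ)
    (Real.rpow_lt_one (by norm_num) (by norm_num) hγ0)
  set K : ℝ := (1 / 2) ^ (ρ - 1 / p) with hK
  set m := ENNReal.ofReal M with hm
  have hscale : ∀ n : ℕ,
      ENNReal.ofReal (((1 / 2 : ℝ) ^ (n + 1))⁻¹ * ((1 / 2 : ℝ) ^ n) ^ (p / 2)) ^ (1 / p) *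
        ENNReal.ofReal ((1 / 2) ^ (n + 1)) ^ ρ =
      ENNReal.ofReal (((1 / 2) ^ γ) ^ n) * ENNReal.ofReal K := fun n => by
    rw [ENNReal.ofReal_rpow_of_nonneg (by positivity) (by positivity),
      ENNReal.ofReal_rpow_of_nonneg (by positivity) hρ0, ← ENNReal.ofReal_mul (by positivity),
      ← ENNReal.ofReal_mul (by positivity)]
    congr 1
    have h2 : (0 : ℝ) < 1 / 2 := by norm_num
    rw [← Real.rpow_natCast, ← Real.rpow_natCast, ← Real.rpow_natCast, ← Real.rpow_neg h2.le,
      ← Real.rpow_mul h2.le, ← Real.rpow_add h2, ← Real.rpow_mul h2.le, ← Real.rpow_mul h2.le,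
      ← Real.rpow_add h2, hK, ← Real.rpow_mul h2.le, ← Real.rpow_add h2, hγ]
    congr 1
    push_cast
    field_simp
    ring
  refine ⟨C * (m * m * m * ENNReal.ofReal K * ENNReal.ofReal 2 ^ (1 / p)), ?_, ?_⟩
  · refine ENNReal.mul_ne_top hC (ENNReal.mul_ne_top ?_
      (ENNReal.rpow_ne_top_of_nonneg (by positivity) ENNReal.ofReal_ne_top))
    simp only [hm, ← ENNReal.ofReal_mul' hM0.le]
    exact ENNReal.mul_ne_top ENNReal.ofReal_ne_top ENNReal.ofReal_ne_top
  intro g f hg hf hper hgfin _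
  set A := eLp qc₂ volume
    (fun t => eLp s (volume.restrict (Ioc (0:ℝ) 1)) fun τ => (‖f t τ‖₊ : ℝ≥0∞)) with hA
  set H := gagliardoDensity p g with hH
  have hHm : Measurable H := measurable_gagliardoDensity p hg
  change (∫⁻ t, H t) ^ (1 / p) < ∞ at hgfin
  change _ ≤ _ * (∫⁻ t, H t) ^ (1 / p) * A
  have hHfin : ∫⁻ t, H t ≠ ∞ := fun h => by
    rw [h, ENNReal.top_rpow_of_pos (by positivity)] at hgfin
    exact hgfin.ne rfl
  have hfe : Measurable fun z : ℝ × ℝ => ‖f z.1 z.2‖ₑ := hf.enorm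
  have hfs : Measurable fun z : ℝ × ℝ => ‖f z.2 z.1‖ₑ ^ e :=
    (hfe.comp measurable_swap).pow_const e
  have hft : ∀ t, Measurable fun w => ‖f w t‖ₑ := fun t => hfe.comp measurable_prodMk_right
  set D : ℕ → ℝ → ℝ≥0∞ := fun n => localMass ((1 / 2) ^ (n + 1)) H with hD
  have hDm : ∀ n, Measurable (D n) := fun n => measurable_localMass _ hHm
  set L : ℝ → ℝ≥0∞ := fun t => localMass 1 (fun w => ‖f w t‖ₑ ^ e) t with hL
  have hLm : Measurable L := measurable_setLIntegral_Icc 1 (F := fun t w => ‖f w t‖ₑ ^ e) hfs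
  set c : ℕ → ℝ≥0∞ := fun n =>
    ENNReal.ofReal (((1 / 2 : ℝ) ^ (n + 1))⁻¹ * ((1 / 2 : ℝ) ^ n) ^ (p / 2)) with hc
  set a : ℕ → ℝ → ℝ≥0∞ := fun n t =>
    m * m * (c n * D n t) ^ (1 / p) * (m * L t ^ (1 / e)) with ha
  have ham : ∀ n, Measurable (a n) := fun n =>
    ((((hDm n).const_mul _).pow_const _).const_mul _).mul ((hLm.pow_const _).const_mul _)
  have hf_le : ∀ t, ‖∫ σ : ℝ, f (t - σ) t * φ₁ σ‖ₑ ≤ m * L t ^ (1 / e) := fun t => by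
    refine (enorm_integral_le_lintegral_enorm _).trans ?_
    have := lintegral_mul_kernel_le hM (fun x => hφ₁.eq_zero_of_notMem) one_pos hq t (hft t)
    simpa only [enorm_mul, hφ₁.enorm_eq, one_mul, inv_one, ENNReal.ofReal_one] using this
  have hpt : ∀ᵐ t, ‖(g t - ∫ σ : ℝ, g (t - σ) * φ₁ σ) * ∫ σ : ℝ, f (t - σ) t * φ₁ σ‖ₑ ≤
      ∑' n, a n t := by
    filter_upwards [ae_lt_top hHm hHfin] with t ht
    rw [enorm_mul, ENNReal.tsum_mul_right]
    exact mul_le_mul' (hφ₁.enorm_sub_mollify_le hM hp hg ht.ne) (hf_le t)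
  have hscale_le : ∀ n, ∫⁻ t, a n t ^ e ≤
      (ENNReal.ofReal (((1 / 2) ^ γ) ^ n) * (m * m * m * ENNReal.ofReal K *
        ((ENNReal.ofReal 2 * ∫⁻ t, H t) ^ (1 / p) * A))) ^ e := fun n => by
    have h1 : ∀ t, a n t ^ e = (m * m * m * c n ^ (1 / p)) ^ e *
        ∫⁻ w in Icc (t - 1 / 2) (t + 1 / 2), (D n t ^ (1 / p) * ‖f w t‖ₑ) ^ e := fun t => by
      simp_rw [ENNReal.mul_rpow_of_nonneg (D n t ^ (1 / p)) _ he0.le]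
      rw [lintegral_const_mul _ ((hft t).pow_const e)]
      change _ = _ * (_ * L t)
      have h2 : L t = (L t ^ (1 / e)) ^ e := by
        rw [← ENNReal.rpow_mul, one_div_mul_cancel he0.ne', ENNReal.rpow_one]
      conv_rhs => rw [h2]
      rw [← ENNReal.mul_rpow_of_nonneg _ _ he0.le, ← ENNReal.mul_rpow_of_nonneg _ _ he0.le]
      simp only [ha]
      rw [ENNReal.mul_rpow_of_nonneg (c n) _ (by positivity)]
      congr 1
      ring
    have h3 : (m * m * m * c n ^ (1 / p)) ^ e ≠ ∞ :=
      ENNReal.rpow_ne_top_of_nonneg he0.le (ENNReal.mul_ne_top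
        (ENNReal.mul_ne_top (ENNReal.mul_ne_top ENNReal.ofReal_ne_top ENNReal.ofReal_ne_top)
          ENNReal.ofReal_ne_top)
        (ENNReal.rpow_ne_top_of_nonneg (by positivity) ENNReal.ofReal_ne_top))
    simp_rw [h1]
    rw [lintegral_const_mul' _ _ h3]
    refine (mul_le_mul_right (lintegral_localMass_rpow_mul_le hp hq hs1' hs2 hρ0 hρp hρ hr
      (pow_le_one₀ (by norm_num) (by norm_num)) hHm (Φ := fun t τ => ‖f t τ‖ₑ) hfe
      fun t τ => by rw [hper]) _).trans_eq ?_
    rw [← ENNReal.mul_rpow_of_nonneg _ _ he0.le]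
    congr 1
    change _ * (_ * _ * A) = _
    rw [show ∀ x y z w v : ℝ≥0∞, x * y * (z * w * v) = (y * z) * (x * (w * v)) by intros; ring,
      hscale]
    ring
  have hmain := hCsum a _ ham hscale_le
  rw [eLp_of_ne_top hq2, one_div, ENNReal.rpow_inv_le_iff he0]
  refine (lintegral_mono_ae (hpt.mono fun t ht => ENNReal.rpow_le_rpow ht he0.le)).trans
    (hmain.trans_eq ?_)
  rw [ENNReal.mul_rpow_of_nonneg (ENNReal.ofReal 2) _ (by positivity : (0 : ℝ) ≤ 1 / p)]
  congr 1
  ring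

end
end
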